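/- Let f(n,k) be the number of irreducible ordered pairs of compositions of n into k parts. For all complex x, y of sufficiently small modulus (e.g. |x| < 1/8 and |y| < 1), the double series converges absolutely and ∑_{n,k≥1} f(n,k) x^n y^k = x y (√(1 + x²(1−y)² − 2x(1+y)) − x y) / (1 − 2x(1+y) + x²(1−2y)), where the square root is the principal branch. -/

import Mathlib

/-- `b : Fin k → ℕ` is a composition of `n` into `k` (positive) parts. -/
def IsComposition (n k : ℕ) (b : Fin k → ℕ) : Prop :=
  (∀ i, 0 < b i) ∧ ∑ i, b i = n

/-- An ordered pair of compositions of `n` into `k` parts is irreducible if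
their partial sums disagree at every index `j = 1, …, k-1`. -/
def IsIrreduciblePair (n k : ℕ) (b b' : Fin k → ℕ) : Prop :=
  IsComposition n k b ∧ IsComposition n k b' ∧
    ∀ j : ℕ, 1 ≤ j → j < k →
      ∑ i ∈ Finset.univ.filter (fun i : Fin k => (i : ℕ) < j), b i ≠
        ∑ i ∈ Finset.univ.filter (fun i : Fin k => (i : ℕ) < j), b' i

/-- `f n k` is the number of irreducible ordered pairs of compositions of `n`
into `k` parts. -/
noncomputable def numIrreduciblePairsK (n k : ℕ) : ℕ :=
  Nat.card {p : (Fin k → ℕ) × (Fin k → ℕ) // IsIrreduciblePair n k p.1 p.2}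

open Finset in
/-- The compositions of `n` into `k` parts, as a finset. -/
def compositionFinset (n k : ℕ) : Finset (Fin k → ℕ) :=
  (finAntidiagonal k n).filter fun b => ∀ i, 0 < b i

theorem mem_compositionFinset {n k : ℕ} {b : Fin k → ℕ} :
    b ∈ compositionFinset n k ↔ IsComposition n k b := by
  simp [compositionFinset, IsComposition, and_comm]

/-- The sum of the first `j` parts of `b`. -/
def initialSum {k : ℕ} (b : Fin k → ℕ) (j : ℕ) : ℕ :=
  ∑ i ∈ Finset.univ.filter (fun i : Fin k => (i : ℕ) < j), b i

theorem initialSum_self {k : ℕ} (b : Fin k → ℕ) : initialSum b k = ∑ i, b i := by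
  simp [initialSum]

theorem initialSum_append {j l i : ℕ} (b : Fin j → ℕ) (c : Fin l → ℕ) (hi : i ≤ j) :
    initialSum (Fin.append b c) i = initialSum b i := by
  have h : ∀ a : Fin l, ¬ j + (a : ℕ) < i := fun a => by omega
  simp [initialSum, Finset.sum_filter, Fin.sum_univ_add, h]

theorem isComposition_append {n j l : ℕ} {b : Fin j → ℕ} {c : Fin l → ℕ} :
    IsComposition n (j + l) (Fin.append b c) ↔
      (∀ i, 0 < b i) ∧ (∀ i, 0 < c i) ∧ ∑ i, b i + ∑ i, c i = n := by
  simp [IsComposition, Fin.forall_fin_add, Fin.sum_univ_add, and_assoc]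

open Classical in
/-- The irreducible pairs of compositions of `n` into `k` parts, as a finset. -/
noncomputable def irreducibleFinset (n k : ℕ) : Finset ((Fin k → ℕ) × (Fin k → ℕ)) :=
  (compositionFinset n k ×ˢ compositionFinset n k).filter fun p => IsIrreduciblePair n k p.1 p.2

theorem mem_irreducibleFinset {n k : ℕ} {p : (Fin k → ℕ) × (Fin k → ℕ)} :
    p ∈ irreducibleFinset n k ↔ IsIrreduciblePair n k p.1 p.2 := by
  simp only [irreducibleFinset, Finset.mem_filter, Finset.mem_product, mem_compositionFinset]
  exact ⟨fun h => h.2, fun h => ⟨⟨h.1, h.2.1⟩, h⟩⟩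

theorem card_irreducibleFinset (n k : ℕ) :
    (irreducibleFinset n k).card = numIrreduciblePairsK n k :=
  (Nat.subtype_card _ fun _ => mem_irreducibleFinset).symm

theorem numIrreduciblePairsK_le (n k : ℕ) :
    numIrreduciblePairsK n k ≤ (compositionFinset n k).card ^ 2 := by
  rw [← card_irreducibleFinset, sq, ← Finset.card_product]
  refine Finset.card_le_card fun p hp => ?_
  obtain ⟨h, h', -⟩ := mem_irreducibleFinset.1 hp
  exact Finset.mem_product.2 ⟨mem_compositionFinset.2 h, mem_compositionFinset.2 h'⟩

theorem card_compositionFinset (n k : ℕ) :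
    (compositionFinset (n + 1) (k + 1)).card = n.choose k := by
  by_cases h : k ≤ n
  · have key := Finset.card_finsuppAntidiag_nat_eq_choose
      (s := (Finset.univ : Finset (Fin (k + 1)))) (n - k)
    have e : (Finset.univ : Finset (Fin (k + 1))).card + (n - k) - 1 = n := by
      simp only [Finset.card_univ, Fintype.card_fin]; omega
    rw [e, Nat.choose_symm h] at key
    rw [← key]
    refine Finset.card_bij' (fun b _ => Finsupp.equivFunOnFinite.symm fun i => b i - 1)
      (fun b _ i => b i + 1) ?_ ?_ ?_ ?_
    · intro b hb
      obtain ⟨h0, h1⟩ := mem_compositionFinset.1 hb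
      have : ∑ i, (b i - 1) + ∑ _i : Fin (k + 1), 1 = n + 1 := by
        rw [← Finset.sum_add_distrib, ← h1]
        exact Finset.sum_congr rfl fun i _ => Nat.sub_add_cancel (h0 i)
      simp only [Finset.sum_const, Finset.card_univ, Fintype.card_fin, smul_eq_mul] at this
      simp only [Finset.mem_finsuppAntidiag, Finset.subset_univ, and_true]
      simp only [Finsupp.equivFunOnFinite_symm_apply_apply]
      omega
    · intro b hb
      simp only [Finset.mem_finsuppAntidiag, Finset.subset_univ, and_true] at hb
      refine mem_compositionFinset.2 ⟨fun i => Nat.succ_pos _, ?_⟩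
      simp only [Finset.sum_add_distrib, hb, Finset.sum_const, Finset.card_univ, Fintype.card_fin,
        smul_eq_mul]
      omega
    · intro b hb
      funext i
      exact Nat.sub_add_cancel ((mem_compositionFinset.1 hb).1 i)
    · intro b _
      ext i
      simp
  · rw [Nat.choose_eq_zero_of_lt (by omega), Finset.card_eq_zero, Finset.eq_empty_iff_forall_notMem]
    intro b hb
    obtain ⟨h0, h1⟩ := mem_compositionFinset.1 hb
    have : ∑ _i : Fin (k + 1), 1 ≤ ∑ i, b i := Finset.sum_le_sum fun i _ => h0 i
    simp only [Finset.sum_const, Finset.card_univ, Fintype.card_fin, smul_eq_mul] at this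
    omega

theorem card_compositionFinset_zero_zero : (compositionFinset 0 0).card = 1 := by
  rw [Finset.card_eq_one]
  refine ⟨Fin.elim0, Finset.eq_singleton_iff_unique_mem.2 ⟨?_, fun _ _ => Subsingleton.elim _ _⟩⟩
  simp [mem_compositionFinset, IsComposition]

theorem card_compositionFinset_succ_zero (n : ℕ) : (compositionFinset (n + 1) 0).card = 0 := by
  simp [Finset.eq_empty_iff_forall_notMem, mem_compositionFinset, IsComposition]

theorem card_compositionFinset_of_lt {n k : ℕ} (h : n < k) : (compositionFinset n k).card = 0 := by
  obtain ⟨k, rfl⟩ : ∃ m, k = m + 1 := ⟨k - 1, by omega⟩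
  cases n with
  | zero =>
    rw [Finset.card_eq_zero, Finset.eq_empty_iff_forall_notMem]
    intro b hb
    obtain ⟨h0, h1⟩ := mem_compositionFinset.1 hb
    exact (h0 0).ne' (by simpa using (Finset.sum_eq_zero_iff.1 h1) 0 (Finset.mem_univ _))
  | succ n => rw [card_compositionFinset, Nat.choose_eq_zero_of_lt (by omega)]

/-- The pair `p` has its first coincidence of partial sums at `j`, with common value `s`. -/
def FirstMeetsAt {k : ℕ} (j s : ℕ) (p : (Fin k → ℕ) × (Fin k → ℕ)) : Prop :=
  initialSum p.1 j = s ∧ initialSum p.2 j = s ∧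
    ∀ i, 1 ≤ i → i < j → initialSum p.1 i ≠ initialSum p.2 i

open Classical in
theorem card_filter_firstMeetsAt {n k j l s t : ℕ} (hk : k = j + l) (hn : n = s + t) :
    ((compositionFinset n k ×ˢ compositionFinset n k).filter (FirstMeetsAt j s)).card =
      numIrreduciblePairsK s j * (compositionFinset t l).card ^ 2 := by
  subst hk hn
  rw [← card_irreducibleFinset, sq, ← Finset.card_product, ← Finset.card_product]
  refine (Finset.card_equiv ((Equiv.prodProdProdComm _ _ _ _).trans
    ((Fin.appendEquiv j l).prodCongr (Fin.appendEquiv j l))) ?_).symm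
  rintro ⟨⟨b, b'⟩, c, c'⟩
  have hi : (∀ i, 1 ≤ i → i < j →
      initialSum (Fin.append b c) i ≠ initialSum (Fin.append b' c') i) ↔
      ∀ i, 1 ≤ i → i < j → initialSum b i ≠ initialSum b' i :=
    forall_congr' fun i => forall_congr' fun _ => forall_congr' fun h => by
      rw [initialSum_append _ _ h.le, initialSum_append _ _ h.le]
  have he : ((Equiv.prodProdProdComm _ _ _ _).trans
      ((Fin.appendEquiv j l).prodCongr (Fin.appendEquiv j l))) ((b, b'), c, c') =
      (Fin.append b c, Fin.append b' c') := rfl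
  rw [he]
  simp only [Finset.mem_product, Finset.mem_filter, mem_irreducibleFinset, mem_compositionFinset,
    isComposition_append, FirstMeetsAt, hi, initialSum_append _ _ le_rfl, initialSum_self,
    IsIrreduciblePair]
  simp only [initialSum, IsComposition]
  constructor
  · rintro ⟨⟨⟨h1, h2⟩, ⟨h3, h4⟩, h5⟩, ⟨h6, h7⟩, h8, h9⟩
    exact ⟨⟨⟨h1, h6, by omega⟩, h3, h8, by omega⟩, h2, h4, h5⟩
  · rintro ⟨⟨⟨h1, h6, h7⟩, h3, h8, h9⟩, h2, h4, h5⟩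
    exact ⟨⟨⟨h1, h2⟩, ⟨h3, h4⟩, h5⟩, ⟨h6, by omega⟩, h8, by omega⟩

/-- Splitting a pair of compositions at the first coincidence of partial sums. -/
theorem card_compositionFinset_sq (n k : ℕ) :
    (compositionFinset n (k + 1)).card ^ 2 =
      ∑ p ∈ Finset.HasAntidiagonal.antidiagonal n, ∑ q ∈ Finset.HasAntidiagonal.antidiagonal k,
        numIrreduciblePairsK p.1 (q.1 + 1) * (compositionFinset p.2 q.2).card ^ 2 := by
  classical
  have hcard : ∀ r ∈ Finset.HasAntidiagonal.antidiagonal n ×ˢ Finset.HasAntidiagonal.antidiagonal k,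
      ((compositionFinset n (k + 1) ×ˢ compositionFinset n (k + 1)).filter
        (FirstMeetsAt (r.2.1 + 1) r.1.1)).card =
      numIrreduciblePairsK r.1.1 (r.2.1 + 1) * (compositionFinset r.1.2 r.2.2).card ^ 2 := by
    intro r hr
    rw [Finset.mem_product, Finset.HasAntidiagonal.mem_antidiagonal, Finset.HasAntidiagonal.mem_antidiagonal] at hr
    exact card_filter_firstMeetsAt (by omega) (by omega)
  rw [← Finset.sum_product', ← Finset.sum_congr rfl hcard, ← Finset.card_biUnion, sq,
    ← Finset.card_product]
  · congr 1
    ext p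
    simp only [Finset.mem_biUnion, Finset.mem_filter]
    refine ⟨fun hp => ?_, fun ⟨_, _, hp, _⟩ => hp⟩
    obtain ⟨⟨-, h1⟩, -, h2⟩ := (Finset.mem_product.1 hp).imp mem_compositionFinset.1
      mem_compositionFinset.1
    rw [← initialSum_self] at h1 h2
    have hex : ∃ j, initialSum p.1 (j + 1) = initialSum p.2 (j + 1) := ⟨k, h1.trans h2.symm⟩
    have hle : Nat.find hex ≤ k := Nat.find_min' hex (h1.trans h2.symm)
    have hs : initialSum p.1 (Nat.find hex + 1) ≤ n := by
      rw [← h1, initialSum_self]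
      exact Finset.sum_le_sum_of_subset (Finset.filter_subset _ _)
    refine ⟨((initialSum p.1 (Nat.find hex + 1), n - initialSum p.1 (Nat.find hex + 1)),
      (Nat.find hex, k - Nat.find hex)), ?_, hp, rfl, (Nat.find_spec hex).symm, ?_⟩
    · simp only [Finset.mem_product, Finset.HasAntidiagonal.mem_antidiagonal]
      omega
    · intro i hi hlt
      obtain ⟨i, rfl⟩ : ∃ m, i = m + 1 := ⟨i - 1, by omega⟩
      exact Nat.find_min hex (by simpa using hlt)
  · intro r hr r' hr' hne
    rw [Function.onFun, Finset.disjoint_left]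
    intro p hp hp'
    obtain ⟨-, h1, h2, h3⟩ := Finset.mem_filter.1 hp
    obtain ⟨-, h1', h2', h3'⟩ := Finset.mem_filter.1 hp'
    have hj : r.2.1 = r'.2.1 := by
      rcases lt_trichotomy r.2.1 r'.2.1 with h | h | h
      · exact absurd (h1.trans h2.symm) (h3' _ (by omega) (by omega))
      · exact h
      · exact absurd (h1'.trans h2'.symm) (h3 _ (by omega) (by omega))
    have hs : r.1.1 = r'.1.1 := by rw [← h1, ← h1', hj]
    simp only [Finset.coe_product, Set.mem_prod, Finset.mem_coe, Finset.HasAntidiagonal.mem_antidiagonal] at hr hr'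
    exact hne (Prod.ext (Prod.ext hs (by omega)) (Prod.ext hj (by omega)))

open PowerSeries

/-- The power series `A` converges absolutely at `x`, with sum `a`. -/
def HasAbsSum (A : ℂ⟦X⟧) (x a : ℂ) : Prop :=
  (Summable fun n => ‖coeff n A * x ^ n‖) ∧ ∑' n, coeff n A * x ^ n = a

namespace HasAbsSum

variable {A B : ℂ⟦X⟧} {x a b : ℂ}

theorem unique (ha : HasAbsSum A x a) (hb : HasAbsSum A x b) : a = b :=
  ha.2.symm.trans hb.2

theorem add (ha : HasAbsSum A x a) (hb : HasAbsSum B x b) : HasAbsSum (A + B) x (a + b) := by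
  have h : ∀ n, coeff n (A + B) * x ^ n = coeff n A * x ^ n + coeff n B * x ^ n := fun n => by
    rw [map_add, add_mul]
  refine ⟨?_, ?_⟩
  · simp only [h]
    exact (ha.1.add hb.1).of_nonneg_of_le (fun _ => norm_nonneg _) fun _ => norm_add_le _ _
  · simp only [h]
    rw [ha.1.of_norm.tsum_add hb.1.of_norm, ha.2, hb.2]

theorem mul (ha : HasAbsSum A x a) (hb : HasAbsSum B x b) : HasAbsSum (A * B) x (a * b) := by
  have h : ∀ n, coeff n (A * B) * x ^ n = ∑ p ∈ Finset.HasAntidiagonal.antidiagonal n,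
      (coeff p.1 A * x ^ p.1) * (coeff p.2 B * x ^ p.2) := fun n => by
    rw [coeff_mul, Finset.sum_mul]
    refine Finset.sum_congr rfl fun p hp => ?_
    rw [← Finset.HasAntidiagonal.mem_antidiagonal.1 hp, pow_add]
    ring
  refine ⟨?_, ?_⟩
  · simp only [h]
    exact summable_norm_sum_mul_antidiagonal_of_summable_norm (f := fun n => coeff n A * x ^ n)
      (g := fun n => coeff n B * x ^ n) ha.1 hb.1
  · simp only [h]
    rw [← tsum_mul_tsum_eq_tsum_sum_antidiagonal_of_summable_norm
      (f := fun n => coeff n A * x ^ n) (g := fun n => coeff n B * x ^ n) ha.1 hb.1, ha.2, hb.2]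

theorem monomial (m : ℕ) (c x : ℂ) : HasAbsSum (PowerSeries.monomial m c) x (c * x ^ m) := by
  have h : ∀ n, n ≠ m → coeff n (PowerSeries.monomial m c) * x ^ n = 0 := fun n hn => by
    rw [coeff_monomial, if_neg hn, zero_mul]
  refine ⟨summable_of_ne_finset_zero (s := {m}) fun n hn => ?_, ?_⟩
  · rw [h n (by simpa using hn), norm_zero]
  · rw [tsum_eq_single m h, coeff_monomial_same]

theorem C (c x : ℂ) : HasAbsSum (PowerSeries.C c) x c := by
  simpa using monomial 0 c x

theorem X (x : ℂ) : HasAbsSum PowerSeries.X x x := by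
  simpa [X_eq] using monomial 1 1 x

end HasAbsSum

/-- `∑ j, (m.choose j)² yʲ`. -/
noncomputable def chooseSqPoly (m : ℕ) : Polynomial ℂ :=
  ∑ j ∈ Finset.range (m + 1), Polynomial.monomial j ((m.choose j : ℂ) ^ 2)

theorem coeff_chooseSqPoly (m j : ℕ) : (chooseSqPoly m).coeff j = (m.choose j : ℂ) ^ 2 := by
  simp only [chooseSqPoly, Polynomial.finsetSum_coeff, Polynomial.coeff_monomial,
    Finset.sum_ite_eq', Finset.mem_range]
  split_ifs with h
  · rfl
  · rw [Nat.choose_eq_zero_of_lt (by omega)]; simp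

theorem choose_succ_mul (m k : ℕ) :
    (m.choose (k + 1) : ℂ) * (k + 1) = m.choose k * (m - k) := by
  rcases le_or_gt k m with h | h
  · have := Nat.choose_succ_right_eq m k
    rw [← Nat.cast_sub h]
    exact_mod_cast this
  · simp [Nat.choose_eq_zero_of_lt h, Nat.choose_eq_zero_of_lt (h.trans (Nat.lt_succ_self k))]

theorem chooseSqPoly_recurrence (m : ℕ) :
    ((m : Polynomial ℂ) + 2) * chooseSqPoly (m + 2) =
      (2 * (m : Polynomial ℂ) + 3) * (1 + Polynomial.X) * chooseSqPoly (m + 1) -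
        ((m : Polynomial ℂ) + 1) * (1 - Polynomial.X) ^ 2 * chooseSqPoly m := by
  have e1 : ((m : Polynomial ℂ) + 2) * chooseSqPoly (m + 2) =
      Polynomial.C ((m : ℂ) + 2) * chooseSqPoly (m + 2) := by
    simp only [map_add, map_natCast, map_ofNat]
  have e2 : (2 * (m : Polynomial ℂ) + 3) * (1 + Polynomial.X) * chooseSqPoly (m + 1) =
      Polynomial.C (2 * (m : ℂ) + 3) *
        (chooseSqPoly (m + 1) + chooseSqPoly (m + 1) * Polynomial.X) := by
    simp only [map_add, map_mul, map_natCast, map_ofNat]; ring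
  have e3 : ((m : Polynomial ℂ) + 1) * (1 - Polynomial.X) ^ 2 * chooseSqPoly m =
      Polynomial.C ((m : ℂ) + 1) * (chooseSqPoly m - Polynomial.C 2 * (chooseSqPoly m * Polynomial.X)
        + chooseSqPoly m * Polynomial.X * Polynomial.X) := by
    simp only [map_add, map_natCast, map_ofNat, map_one]; ring
  rw [e1, e2, e3]
  ext j
  rcases j with _ | _ | k
  · simp [coeff_chooseSqPoly]
    ring
  · simp only [Polynomial.coeff_C_mul, coeff_chooseSqPoly, Polynomial.coeff_add,
      Polynomial.coeff_sub, Polynomial.coeff_mul_X, Polynomial.coeff_mul_X_zero, zero_add,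
      Nat.choose_one_right, Nat.choose_zero_right]
    push_cast
    ring
  · simp only [Polynomial.coeff_C_mul, coeff_chooseSqPoly, Polynomial.coeff_add,
      Polynomial.coeff_sub, Polynomial.coeff_mul_X, Nat.choose_succ_succ' (m + 1) (k + 1),
      Nat.choose_succ_succ' m (k + 1), Nat.choose_succ_succ' m k]
    have h1 := choose_succ_mul m (k + 1)
    have h2 := choose_succ_mul m k
    push_cast at h1 h2 ⊢
    linear_combination ((m.choose k : ℂ) + m.choose (k + 1)) * 2 * h1 -
      2 * ((m.choose (k + 1) : ℂ) + m.choose (k + 2)) * h2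

/-- `∑ m, (∑ j, (m.choose j)² yʲ) Xᵐ`. -/
noncomputable def chooseSqSeries (y : ℂ) : ℂ⟦X⟧ :=
  mk fun m => (chooseSqPoly m).eval y

/-- `1 - 2 (1 + y) X + (1 - y)² X²`. -/
noncomputable def discrSeries (y : ℂ) : ℂ⟦X⟧ :=
  1 + C (-2 * (1 + y)) * X + C ((1 - y) ^ 2) * (X * X)

theorem discrSeries_mul_derivative (y : ℂ) :
    discrSeries y * derivative ℂ (chooseSqSeries y) =
      (C (1 + y) + C (-(1 - y) ^ 2) * X) * chooseSqSeries y := by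
  have e1 : discrSeries y * derivative ℂ (chooseSqSeries y) =
      derivative ℂ (chooseSqSeries y) + C (-2 * (1 + y)) * (derivative ℂ (chooseSqSeries y) * X) +
        C ((1 - y) ^ 2) * (derivative ℂ (chooseSqSeries y) * X * X) := by
    rw [discrSeries]; ring
  have e2 : (C (1 + y) + C (-(1 - y) ^ 2) * X) * chooseSqSeries y =
      C (1 + y) * chooseSqSeries y + C (-(1 - y) ^ 2) * (chooseSqSeries y * X) := by ring
  have hrec := fun m : ℕ => congrArg (Polynomial.eval y) (chooseSqPoly_recurrence m)
  simp only [Polynomial.eval_mul, Polynomial.eval_add, Polynomial.eval_sub, Polynomial.eval_pow,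
    Polynomial.eval_natCast, Polynomial.eval_ofNat, Polynomial.eval_one, Polynomial.eval_X] at hrec
  rw [e1, e2]
  ext n
  rcases n with _ | _ | n
  · simp only [LinearMap.map_add, coeff_C_mul, coeff_zero_mul_X, coeff_derivative, chooseSqSeries,
      coeff_mk]
    simp [chooseSqPoly, Finset.sum_range_succ]
  · have := hrec 0
    simp only [LinearMap.map_add, coeff_C_mul, coeff_succ_mul_X, coeff_zero_mul_X,
      coeff_derivative, chooseSqSeries, coeff_mk, zero_add]
    push_cast at this ⊢
    linear_combination this
  · have := hrec (n + 1)
    simp only [LinearMap.map_add, coeff_C_mul, coeff_succ_mul_X, coeff_derivative, chooseSqSeries,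
      coeff_mk]
    push_cast at this ⊢
    linear_combination this

theorem chooseSqSeries_sq_mul_discrSeries (y : ℂ) :
    chooseSqSeries y * chooseSqSeries y * discrSeries y = 1 := by
  refine derivative.ext ?_ ?_
  · have h := discrSeries_mul_derivative y
    have hD : derivative ℂ (discrSeries y) =
        -2 * (C (1 + y) + C (-(1 - y) ^ 2) * X) := by
      simp only [discrSeries, map_add, Derivation.leibniz, derivative_C, derivative_X, smul_eq_mul,
        derivative_one]
      simp only [map_add, map_neg, map_mul, map_ofNat]
      ring
    simp only [Derivation.leibniz, smul_eq_mul, hD, derivative_one]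
    linear_combination 2 * chooseSqSeries y * h
  · simp [chooseSqSeries, discrSeries, chooseSqPoly]

/-- `∑ k ≥ 1, f(n,k) yᵏ`. -/
noncomputable def irreduciblePoly (n : ℕ) : Polynomial ℂ :=
  ∑ k ∈ Finset.range n, Polynomial.monomial (k + 1) (numIrreduciblePairsK n (k + 1) : ℂ)

theorem numIrreduciblePairsK_of_lt {n k : ℕ} (h : n < k) : numIrreduciblePairsK n k = 0 := by
  simpa [card_compositionFinset_of_lt h] using numIrreduciblePairsK_le n k

theorem coeff_irreduciblePoly_zero (n : ℕ) : (irreduciblePoly n).coeff 0 = 0 := by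
  simp [irreduciblePoly, Polynomial.coeff_monomial]

theorem coeff_irreduciblePoly_succ (n k : ℕ) :
    (irreduciblePoly n).coeff (k + 1) = numIrreduciblePairsK n (k + 1) := by
  simp only [irreduciblePoly, Polynomial.finsetSum_coeff, Polynomial.coeff_monomial,
    add_left_inj, Finset.sum_ite_eq', Finset.mem_range]
  split_ifs with h
  · rfl
  · rw [numIrreduciblePairsK_of_lt (by omega), Nat.cast_zero]

/-- `∑ k, c(n,k)² yᵏ`, where `c(n,k)` is the number of compositions of `n` into `k` parts. -/
noncomputable def pairPoly (n : ℕ) : Polynomial ℂ :=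
  ∑ k ∈ Finset.range (n + 1), Polynomial.monomial k ((compositionFinset n k).card ^ 2 : ℂ)

theorem coeff_pairPoly (n k : ℕ) : (pairPoly n).coeff k = ((compositionFinset n k).card ^ 2 : ℂ) := by
  simp only [pairPoly, Polynomial.finsetSum_coeff, Polynomial.coeff_monomial,
    Finset.sum_ite_eq', Finset.mem_range]
  split_ifs with h
  · rfl
  · rw [card_compositionFinset_of_lt (by omega)]; simp

theorem pairPoly_zero : pairPoly 0 = 1 := by
  simp [pairPoly, card_compositionFinset_zero_zero]

theorem pairPoly_succ (n : ℕ) : pairPoly (n + 1) = Polynomial.X * chooseSqPoly n := by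
  ext k
  cases k with
  | zero => simp [coeff_pairPoly, card_compositionFinset_succ_zero]
  | succ k => rw [Polynomial.coeff_X_mul, coeff_pairPoly, coeff_chooseSqPoly, card_compositionFinset]

theorem sum_irreduciblePoly_mul_pairPoly (n : ℕ) :
    ∑ p ∈ Finset.HasAntidiagonal.antidiagonal (n + 1), irreduciblePoly p.1 * pairPoly p.2 = pairPoly (n + 1) := by
  ext k
  simp only [Polynomial.finsetSum_coeff, Polynomial.coeff_mul]
  cases k with
  | zero => simp [coeff_irreduciblePoly_zero, coeff_pairPoly, card_compositionFinset_succ_zero]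
  | succ k =>
    simp only [Finset.Nat.sum_antidiagonal_succ (n := k), coeff_irreduciblePoly_zero, zero_mul,
      zero_add, coeff_irreduciblePoly_succ, coeff_pairPoly]
    exact_mod_cast (card_compositionFinset_sq (n + 1) k).symm

/-- `∑ n, (∑ k ≥ 1, f(n,k) yᵏ) Xⁿ`. -/
noncomputable def irreducibleSeries (y : ℂ) : ℂ⟦X⟧ :=
  mk fun n => (irreduciblePoly n).eval y

theorem irreducibleSeries_mul (y : ℂ) :
    irreducibleSeries y * (1 + C y * X * chooseSqSeries y) = C y * X * chooseSqSeries y := by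
  have hT : 1 + C y * X * chooseSqSeries y = mk fun n => (pairPoly n).eval y := by
    rw [show C y * X * chooseSqSeries y = C y * (chooseSqSeries y * X) by ring]
    ext n
    cases n with
    | zero => simp [pairPoly_zero]
    | succ n => simp [pairPoly_succ, coeff_succ_mul_X, chooseSqSeries, coeff_one]
  rw [hT, eq_sub_of_add_eq' hT]
  ext n
  cases n with
  | zero => simp [irreducibleSeries, irreduciblePoly, pairPoly_zero]
  | succ n =>
    have := congrArg (Polynomial.eval y) (sum_irreduciblePoly_mul_pairPoly n)
    simpa [coeff_mul, irreducibleSeries, coeff_one, Polynomial.eval_finsetSum] using this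

theorem sum_choose_sq_le (n : ℕ) :
    ∑ k ∈ Finset.range (n + 1), (n.choose k : ℝ) ^ 2 ≤ 4 ^ n := by
  calc ∑ k ∈ Finset.range (n + 1), (n.choose k : ℝ) ^ 2
      ≤ (∑ k ∈ Finset.range (n + 1), (n.choose k : ℝ)) ^ 2 :=
        Finset.sum_sq_le_sq_sum_of_nonneg fun _ _ => Nat.cast_nonneg _
    _ = 4 ^ n := by
        rw [← Nat.cast_sum, Nat.sum_range_choose, Nat.cast_pow, ← pow_mul, mul_comm, pow_mul]
        norm_num

theorem norm_eval_chooseSqPoly_le (n : ℕ) {y : ℂ} (hy : ‖y‖ < 1) :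
    ‖(chooseSqPoly n).eval y‖ ≤ 4 ^ n := by
  simp only [chooseSqPoly, Polynomial.eval_finsetSum, Polynomial.eval_monomial]
  refine (norm_sum_le _ _).trans (le_trans (Finset.sum_le_sum fun k _ => ?_) (sum_choose_sq_le n))
  rw [norm_mul, norm_pow, norm_pow, Complex.norm_natCast]
  exact mul_le_of_le_one_right (by positivity) (pow_le_one₀ (norm_nonneg _) hy.le)

theorem norm_term_le (n k : ℕ) (x : ℂ) {y : ℂ} (hy : ‖y‖ < 1) :
    ‖(numIrreduciblePairsK (n + 1) (k + 1) : ℂ) * x ^ (n + 1) * y ^ (k + 1)‖ ≤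
      (n.choose k : ℝ) ^ 2 * ‖x‖ ^ (n + 1) := by
  rw [norm_mul, norm_mul, norm_pow, norm_pow, Complex.norm_natCast]
  refine (mul_le_of_le_one_right (by positivity) (pow_le_one₀ (norm_nonneg _) hy.le)).trans ?_
  gcongr
  have := numIrreduciblePairsK_le (n + 1) (k + 1)
  rw [card_compositionFinset] at this
  exact_mod_cast this

theorem summable_choose_sq {r : ℝ} (h0 : 0 ≤ r) (hr : r < 1 / 8) :
    Summable fun p : ℕ × ℕ => (p.1.choose p.2 : ℝ) ^ 2 * r ^ (p.1 + 1) := by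
  have hz : ∀ n k, k ∉ Finset.range (n + 1) → (n.choose k : ℝ) ^ 2 * r ^ (n + 1) = 0 := by
    intro n k hk
    rw [Finset.mem_range] at hk
    rw [Nat.choose_eq_zero_of_lt (by omega)]
    simp
  rw [summable_prod_of_nonneg fun p => by positivity]
  refine ⟨fun n => summable_of_ne_finset_zero (hz n), ?_⟩
  have hg : Summable fun n : ℕ => (4 * r) ^ n * r :=
    (summable_geometric_of_lt_one (by positivity) (by linarith)).mul_right r
  refine hg.of_nonneg_of_le (fun n => tsum_nonneg fun k => by positivity) fun n => ?_
  rw [tsum_eq_sum (hz n), ← Finset.sum_mul, mul_pow, pow_succ, ← mul_assoc]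
  gcongr
  exact sum_choose_sq_le n

theorem summable_norm_term {x y : ℂ} (hx : ‖x‖ < 1 / 8) (hy : ‖y‖ < 1) :
    Summable fun p : ℕ × ℕ =>
      ‖(numIrreduciblePairsK (p.1 + 1) (p.2 + 1) : ℂ) * x ^ (p.1 + 1) * y ^ (p.2 + 1)‖ :=
  (summable_choose_sq (norm_nonneg x) hx).of_nonneg_of_le (fun _ => norm_nonneg _)
    fun p => norm_term_le p.1 p.2 x hy

theorem hasAbsSum_irreducibleSeries {x y : ℂ} (hx : ‖x‖ < 1 / 8) (hy : ‖y‖ < 1) :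
    HasAbsSum (irreducibleSeries y) x (∑' p : ℕ × ℕ,
      (numIrreduciblePairsK (p.1 + 1) (p.2 + 1) : ℂ) * x ^ (p.1 + 1) * y ^ (p.2 + 1)) := by
  have hs := summable_norm_term hx hy
  have hrow : ∀ n, coeff (n + 1) (irreducibleSeries y) * x ^ (n + 1) =
      ∑' k, (numIrreduciblePairsK (n + 1) (k + 1) : ℂ) * x ^ (n + 1) * y ^ (k + 1) := by
    intro n
    rw [tsum_eq_sum (s := Finset.range (n + 1))]
    · simp only [irreducibleSeries, coeff_mk, irreduciblePoly, Polynomial.eval_finsetSum,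
        Polynomial.eval_monomial, Finset.sum_mul]
      exact Finset.sum_congr rfl fun k _ => by ring
    · intro k hk
      rw [Finset.mem_range] at hk
      rw [numIrreduciblePairsK_of_lt (by omega)]
      simp
  have hsum : Summable fun n => ‖coeff n (irreducibleSeries y) * x ^ n‖ := by
    rw [← summable_nat_add_iff 1]
    refine hs.prod.of_nonneg_of_le (fun _ => norm_nonneg _) fun n => ?_
    rw [hrow]
    exact norm_tsum_le_tsum_norm (hs.prod_factor n)
  refine ⟨hsum, ?_⟩
  rw [hs.of_norm.tsum_prod, hsum.of_norm.tsum_eq_zero_add]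
  simp only [hrow]
  simp [irreducibleSeries, irreduciblePoly]

theorem exists_hasAbsSum_chooseSqSeries {x y : ℂ} (hx : ‖x‖ < 1 / 8) (hy : ‖y‖ < 1) :
    ∃ s, HasAbsSum (chooseSqSeries y) x s ∧ 0 < s.re := by
  have hle : ∀ n, ‖coeff n (chooseSqSeries y) * x ^ n‖ ≤ (4 * ‖x‖) ^ n := by
    intro n
    rw [chooseSqSeries, coeff_mk, norm_mul, norm_pow, mul_pow]
    gcongr
    exact norm_eval_chooseSqPoly_le n hy
  have h4 : 4 * ‖x‖ < 1 := by linarith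
  have hg := summable_geometric_of_lt_one (by positivity) h4
  have hsum := hg.of_nonneg_of_le (fun _ => norm_nonneg _) hle
  refine ⟨_, ⟨hsum, rfl⟩, ?_⟩
  rw [hsum.of_norm.tsum_eq_zero_add]
  have hb : ‖∑' n, coeff (n + 1) (chooseSqSeries y) * x ^ (n + 1)‖ < 1 := by
    have hg' : HasSum (fun n => (4 * ‖x‖) ^ (n + 1)) ((1 - 4 * ‖x‖)⁻¹ * (4 * ‖x‖)) := by
      simpa only [pow_succ] using (hasSum_geometric_of_lt_one (by positivity) h4).mul_right (4 * ‖x‖)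
    refine (tsum_of_norm_bounded hg' fun n => hle (n + 1)).trans_lt ?_
    rw [inv_mul_lt_iff₀ (by linarith)]
    linarith
  have h0 : coeff 0 (chooseSqSeries y) * x ^ 0 = 1 := by simp [chooseSqSeries, chooseSqPoly]
  rw [h0, Complex.add_re, Complex.one_re]
  have := (abs_lt.1 ((Complex.abs_re_le_norm _).trans_lt hb)).1
  linarith

theorem denominator_ne_zero {x y : ℂ} (hx : ‖x‖ < 1 / 8) (hy : ‖y‖ < 1) :
    1 - 2 * x * (1 + y) + x ^ 2 * (1 - 2 * y) ≠ 0 := by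
  intro h
  have h1 : (1 : ℂ) = x * (2 * (1 + y) - x * (1 - 2 * y)) := by linear_combination h
  have h2 : ‖1 + y‖ ≤ 2 := (norm_add_le _ _).trans (by rw [norm_one]; linarith)
  have h3 : ‖1 - 2 * y‖ ≤ 3 := (norm_sub_le _ _).trans (by
    rw [norm_one, norm_mul, Complex.norm_ofNat]; linarith)
  have h4 : ‖2 * (1 + y) - x * (1 - 2 * y)‖ ≤ 2 * 2 + 1 / 8 * 3 := by
    refine (norm_sub_le _ _).trans ?_
    rw [norm_mul, norm_mul, Complex.norm_ofNat]
    gcongr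
  have h5 : (1 : ℝ) ≤ 1 / 8 * (2 * 2 + 1 / 8 * 3) := by
    calc (1 : ℝ) = ‖x * (2 * (1 + y) - x * (1 - 2 * y))‖ := by rw [← h1, norm_one]
      _ ≤ _ := by rw [norm_mul]; gcongr
  norm_num at h5

/-- **Two-variable generating function for irreducible pairs of compositions**:
for `|x| < 1/8` and `|y| < 1`, the double series converges absolutely and
`∑_{n,k≥1} f(n,k) xⁿ yᵏ
  = x y (√(1 + x²(1-y)² - 2x(1+y)) - x y) / (1 - 2x(1+y) + x²(1-2y))`
with the principal branch of the square root. -/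
theorem irreduciblePairsK_gf (x y : ℂ) (hx : ‖x‖ < 1 / 8) (hy : ‖y‖ < 1) :
    (Summable fun p : ℕ × ℕ =>
      ‖(numIrreduciblePairsK (p.1 + 1) (p.2 + 1) : ℂ) *
        x ^ (p.1 + 1) * y ^ (p.2 + 1)‖) ∧
    ∑' p : ℕ × ℕ, (numIrreduciblePairsK (p.1 + 1) (p.2 + 1) : ℂ) *
        x ^ (p.1 + 1) * y ^ (p.2 + 1) =
      x * y * ((1 + x ^ 2 * (1 - y) ^ 2 - 2 * x * (1 + y)) ^ ((1 : ℂ) / 2)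
          - x * y) /
        (1 - 2 * x * (1 + y) + x ^ 2 * (1 - 2 * y)) := by
  refine ⟨summable_norm_term hx hy, ?_⟩
  have hF := hasAbsSum_irreducibleSeries hx hy
  generalize (∑' p : ℕ × ℕ, (numIrreduciblePairsK (p.1 + 1) (p.2 + 1) : ℂ) *
    x ^ (p.1 + 1) * y ^ (p.2 + 1)) = f at hF ⊢
  obtain ⟨s, hS, hre⟩ := exists_hasAbsSum_chooseSqSeries hx hy
  have hone : HasAbsSum 1 x 1 := by simpa using HasAbsSum.C 1 x
  have hD : HasAbsSum (discrSeries y) x (1 + -2 * (1 + y) * x + (1 - y) ^ 2 * (x * x)) :=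
    (hone.add ((HasAbsSum.C _ x).mul (.X x))).add ((HasAbsSum.C _ x).mul ((HasAbsSum.X x).mul (.X x)))
  have hsq : s * s * (1 + -2 * (1 + y) * x + (1 - y) ^ 2 * (x * x)) = 1 := by
    have h := (hS.mul hS).mul hD
    rw [chooseSqSeries_sq_mul_discrSeries] at h
    exact h.unique hone
  have hG : HasAbsSum (C y * X * chooseSqSeries y) x (y * x * s) :=
    ((HasAbsSum.C y x).mul (.X x)).mul hS
  have hf : f * (1 + y * x * s) = y * x * s := by
    have h := hF.mul (hone.add hG)
    rw [irreducibleSeries_mul] at h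
    exact h.unique hG
  have hs : s ≠ 0 := fun h => by simp [h] at hre
  have hroot : 1 + x ^ 2 * (1 - y) ^ 2 - 2 * x * (1 + y) = s⁻¹ ^ 2 := by
    field_simp
    linear_combination hsq
  have hden := denominator_ne_zero hx hy
  have hre' : 0 < s⁻¹.re := by
    rw [Complex.inv_re]
    exact div_pos hre (Complex.normSq_pos.2 hs)
  rw [hroot, one_div, Complex.sq_cpow_two_inv hre', eq_div_iff hden]
  have hden' : 1 - 2 * x * (1 + y) + x ^ 2 * (1 - 2 * y) = (s⁻¹ - x * y) * (s⁻¹ + x * y) := by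
    linear_combination hroot
  have hf' : f * (s⁻¹ + x * y) = x * y := by
    field_simp
    linear_combination hf
  rw [hden']
  linear_combination (s⁻¹ - x * y) * hf'
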